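/- For fixed distinct reals a_1 > ⋯ > a_n and parameters s_1, …, s_n > 0, the Anderson density (Γ(s_1+⋯+s_n)/(Γ(s_1)⋯Γ(s_n))) · Π_{1≤i<j≤n-1}(y_i - y_j) / Π_{1≤i<j≤n}(a_i - a_j)^{s_i+s_j-1} · Π_{i=1}^{n-1} Π_{j=1}^n |y_i - a_j|^{s_j - 1} integrates to 1 over the interlacing region a_1 > y_1 > a_2 > y_2 > ⋯ > y_{n-1} > a_n. -/

import Mathlib

open MeasureTheory

namespace DA

open Finset

/-- weights -/
noncomputable def wt {n : ℕ} (a : Fin (n + 1) → ℝ) (j : Fin (n + 1)) : ℝ :=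
  ∏ k : Fin n, (a j - a (j.succAbove k))

/-- interlacing region -/
def R {n : ℕ} (a : Fin (n + 1) → ℝ) : Set (Fin n → ℝ) :=
  {y | ∀ i : Fin n, a i.succ < y i ∧ y i < a i.castSucc}

noncomputable def Q {n : ℕ} (y : Fin n → ℝ) : Polynomial ℝ :=
  ∏ k, (Polynomial.X - Polynomial.C (y k))

noncomputable def q {n : ℕ} (y : Fin n → ℝ) : Fin (n + 1) → Polynomial ℝ :=
  Fin.cons (Q y) (fun i => ∏ k ∈ univ.erase i, (Polynomial.X - Polynomial.C (y k)))

lemma prod_compl_singleton {n : ℕ} (f : Fin (n + 1) → ℝ) (j : Fin (n + 1)) :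
    ∏ k ∈ ({j} : Finset (Fin (n+1)))ᶜ, f k = ∏ k : Fin n, f (j.succAbove k) := by
  rw [← Fin.image_succAbove_univ, prod_image]
  intro x _ y _ h
  exact Fin.succAbove_right_injective h

lemma offdiag {n : ℕ} (f : Fin (n + 1) → Fin (n + 1) → ℝ) :
    ∏ j, ∏ k : Fin n, f j (j.succAbove k) = ∏ i, ∏ j ∈ Ioi i, (f i j * f j i) := by
  have := prod_prod_Ioi_mul_eq_prod_prod_off_diag (fun i j => f j i)
  rw [this]
  refine prod_congr rfl fun j _ => ?_
  rw [prod_compl_singleton]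

lemma monic_Q {n : ℕ} (y : Fin n → ℝ) : (Q y).Monic :=
  Polynomial.monic_prod_of_monic _ _ fun _ _ => Polynomial.monic_X_sub_C _

lemma natDegree_Q {n : ℕ} (y : Fin n → ℝ) : (Q y).natDegree = n := by
  simp [Q, Polynomial.natDegree_prod_of_monic, Polynomial.monic_X_sub_C]

lemma eval_Q {n : ℕ} (y : Fin n → ℝ) (x : ℝ) : (Q y).eval x = ∏ k, (x - y k) := by
  simp [Q, Polynomial.eval_prod]

lemma degree_lt_of {n : ℕ} {p : Polynomial ℝ} (h : p.natDegree ≤ n) :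
    p.degree < ((univ : Finset (Fin (n+1))).card : WithBot ℕ) := by
  refine lt_of_le_of_lt Polynomial.degree_le_natDegree ?_
  simp only [card_univ, Fintype.card_fin]
  exact_mod_cast Nat.lt_succ_of_le h

lemma poly_ext {n : ℕ} {p p' : Polynomial ℝ} (h : p.natDegree ≤ n) (h' : p'.natDegree ≤ n)
    (v : Fin (n+1) → ℝ) (hv : Function.Injective v) (e : ∀ i, p.eval (v i) = p'.eval (v i)) :
    p = p' :=
  Polynomial.eq_of_degrees_lt_of_eval_index_eq univ hv.injOn (degree_lt_of h) (degree_lt_of h')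
    fun i _ => e i

lemma natDegree_q {n : ℕ} (y : Fin n → ℝ) (c : Fin (n+1)) : (q y c).natDegree ≤ n := by
  refine Fin.cases ?_ (fun i => ?_) c
  · simp [q, natDegree_Q]
  · simp [q, Polynomial.natDegree_prod_of_monic, Polynomial.monic_X_sub_C]

lemma det_q {n : ℕ} (y : Fin n → ℝ) (x : Fin (n+1) → ℝ) :
    (Matrix.of fun j c => (q y c).eval (x j)).det =
    (∏ i, ∏ j ∈ Ioi i, (x j - x i)) *
      (Matrix.of fun (k c : Fin (n+1)) => (q y c).coeff k).det := by
  rw [← Matrix.det_vandermonde, ← Matrix.det_mul]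
  congr 1
  ext j c
  rw [Matrix.mul_apply, Matrix.of_apply,
    Polynomial.eval_eq_sum_range' (Nat.lt_succ_of_le (natDegree_q y c)), ← Fin.sum_univ_eq_sum_range
      (fun i => (q y c).coeff i * x j ^ i)]
  simp [Matrix.vandermonde, mul_comm]

lemma abs_prod_erase {n : ℕ} (y : Fin n → ℝ) :
    |∏ i, ∏ k ∈ univ.erase i, (y i - y k)| = (∏ i, ∏ j ∈ Ioi i, |y j - y i|) ^ 2 := by
  have := prod_prod_Ioi_mul_eq_prod_prod_off_diag (fun i j => |y j - y i|)
  simp only [abs_prod]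
  have h2 : ∀ i : Fin n, univ.erase i = ({i} : Finset (Fin n))ᶜ := by intro i; ext; simp
  simp only [h2]
  rw [← this, sq, ← prod_mul_distrib]
  refine prod_congr rfl fun i _ => ?_
  rw [← prod_mul_distrib]
  refine prod_congr rfl fun j _ => ?_
  rw [abs_sub_comm (y i)]

lemma abs_det_coeff {n : ℕ} (y : Fin n → ℝ) (hy : Function.Injective y) :
    |(Matrix.of fun (k c : Fin (n+1)) => (q y c).coeff k).det| = ∏ i, ∏ j ∈ Ioi i, |y j - y i| := by
  obtain ⟨b, hb⟩ : ∃ b : ℝ, ∀ k, b - y k ≠ 0 := by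
    obtain ⟨b, hb⟩ := (Set.finite_range y).infinite_compl.nonempty
    exact ⟨b, fun k h => hb ⟨k, by linarith⟩⟩
  have h := det_q y (Fin.cons b y)
  have hB : ∏ k, |b - y k| ≠ 0 := by
    rw [prod_ne_zero_iff]; intro k _; exact abs_ne_zero.2 (hb k)
  have hD : ∏ i, ∏ j ∈ Ioi i, |y j - y i| ≠ 0 := by
    rw [prod_ne_zero_iff]; intro i _; rw [prod_ne_zero_iff]; intro j hj
    refine abs_ne_zero.2 (sub_ne_zero.2 fun e => ?_)
    have := hy e; subst this; simp at hj
  rw [Matrix.det_of_isUpperTriangular] at h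
  · simp only [Matrix.of_apply] at h
    rw [Fin.prod_univ_succ, Fin.prod_univ_succ (n := n)] at h
    simp only [Fin.prod_Ioi_zero, Fin.prod_Ioi_succ, Fin.cons_zero, Fin.cons_succ, q, eval_Q,
      Polynomial.eval_prod, Polynomial.eval_sub, Polynomial.eval_X, Polynomial.eval_C] at h
    have h' := congrArg abs h
    rw [abs_mul, abs_prod_erase, abs_mul, abs_mul] at h'
    simp only [abs_prod] at h'
    simp only [abs_sub_comm _ b] at h'
    rw [mul_assoc] at h'
    have h3 := mul_left_cancel₀ hB h'
    rw [sq] at h3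
    exact (mul_left_cancel₀ hD h3).symm
  · intro i j hij
    simp only [id] at hij
    simp only [Matrix.of_apply]
    obtain ⟨i, rfl⟩ := Fin.exists_succ_eq.2 (Fin.ne_zero_of_lt hij)
    revert hij
    refine Fin.cases ?_ (fun j => ?_) j
    · intro _
      simp only [q, Fin.cons_zero, Fin.cons_succ, eval_Q]
      exact prod_eq_zero (mem_univ i) (sub_self _)
    · intro hij
      simp only [q, Fin.cons_succ, Polynomial.eval_prod]
      refine prod_eq_zero (i := i) ?_ (by simp)
      simp only [mem_erase, mem_univ, and_true]
      rintro rfl; simp at hij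

lemma R_lt {n : ℕ} {a : Fin (n + 1) → ℝ} (ha : StrictAnti a) {y : Fin n → ℝ} (hy : y ∈ R a)
    {j : Fin (n+1)} {k : Fin n} (h : j ≤ k.castSucc) : y k < a j :=
  lt_of_lt_of_le (hy k).2 (ha.antitone h)

lemma R_gt {n : ℕ} {a : Fin (n + 1) → ℝ} (ha : StrictAnti a) {y : Fin n → ℝ} (hy : y ∈ R a)
    {j : Fin (n+1)} {k : Fin n} (h : k.castSucc < j) : a j < y k :=
  lt_of_le_of_lt (ha.antitone (Fin.castSucc_lt_iff_succ_le.1 h)) (hy k).1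

lemma R_anti {n : ℕ} {a : Fin (n + 1) → ℝ} (ha : StrictAnti a) {y : Fin n → ℝ} (hy : y ∈ R a) :
    StrictAnti y := by
  intro i j hij
  exact (R_lt ha hy (j := i.succ) (Fin.castSucc_lt_iff_succ_le.1 (by simpa using hij))).trans (hy i).1

lemma ratio_pos {n : ℕ} {a : Fin (n + 1) → ℝ} (ha : StrictAnti a) {y : Fin n → ℝ} (hy : y ∈ R a)
    (j : Fin (n+1)) : 0 < (∏ k, (a j - y k)) / wt a j := by
  rw [wt, ← prod_div_distrib]
  refine prod_pos fun k _ => ?_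
  rcases lt_or_ge k.castSucc j with h | h
  · rw [Fin.succAbove_of_castSucc_lt _ _ h]
    exact div_pos_of_neg_of_neg (sub_neg.2 (R_gt ha hy h)) (sub_neg.2 (ha h))
  · rw [Fin.succAbove_of_le_castSucc _ _ h]
    exact div_pos (sub_pos.2 (R_lt ha hy h))
      (sub_pos.2 (ha (lt_of_le_of_lt h Fin.castSucc_lt_succ)))

lemma wt_ne {n : ℕ} {a : Fin (n + 1) → ℝ} (ha : StrictAnti a) (j : Fin (n+1)) : wt a j ≠ 0 := by
  rw [wt, prod_ne_zero_iff]
  intro k _ h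
  exact Fin.succAbove_ne j k (ha.injective (sub_eq_zero.1 h)).symm

lemma wt_mul_neg {n : ℕ} {a : Fin (n + 1) → ℝ} (ha : StrictAnti a) (i : Fin n) :
    wt a i.castSucc * wt a i.succ < 0 := by
  rw [wt, wt, ← prod_mul_distrib, ← mul_prod_erase _ _ (mem_univ i)]
  refine mul_neg_of_neg_of_pos ?_ (prod_pos fun k hk => ?_)
  · rw [Fin.succAbove_castSucc_self, Fin.succAbove_succ_self]
    have := ha (Fin.castSucc_lt_succ (i := i))
    nlinarith
  · rcases lt_or_gt_of_ne (mem_erase.1 hk).1 with h | h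
    · have h1 : k.castSucc < i.castSucc := by simpa using h
      have h2 : k.castSucc < i.succ := h1.trans Fin.castSucc_lt_succ
      rw [Fin.succAbove_of_castSucc_lt _ _ h1, Fin.succAbove_of_castSucc_lt _ _ h2]
      exact mul_pos_of_neg_of_neg (sub_neg.2 (ha h1)) (sub_neg.2 (ha h2))
    · have h1 : i.castSucc < k.castSucc := by simpa using h
      have h2 : i.succ ≤ k.castSucc := Fin.castSucc_lt_iff_succ_le.1 h1
      rw [Fin.succAbove_of_le_castSucc _ _ h1.le, Fin.succAbove_of_le_castSucc _ _ h2]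
      exact mul_pos (sub_pos.2 (ha (h1.trans Fin.castSucc_lt_succ)))
        (sub_pos.2 (ha (h2.trans_lt Fin.castSucc_lt_succ)))

/-- the change of variables -/
noncomputable def F {n : ℕ} (a : Fin (n + 1) → ℝ) (z : Fin (n+1) → ℝ) (j : Fin (n+1)) : ℝ :=
  z 0 * ((∏ k : Fin n, (a j - z k.succ)) / wt a j)

def S {n : ℕ} (a : Fin (n + 1) → ℝ) : Set (Fin (n+1) → ℝ) :=
  {z | 0 < z 0 ∧ (fun k : Fin n => z k.succ) ∈ R a}

lemma poly_of_F {n : ℕ} {a : Fin (n + 1) → ℝ} (ha : StrictAnti a) {z : Fin (n+1) → ℝ}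
    {p : Polynomial ℝ} (hp : p.natDegree ≤ n) (h : ∀ j, p.eval (a j) = F a z j * wt a j) :
    p = Polynomial.C (z 0) * Q (fun k : Fin n => z k.succ) := by
  refine poly_ext hp ((Polynomial.natDegree_C_mul_le _ _).trans (natDegree_Q _).le) a ha.injective ?_
  intro j
  rw [h, F]
  have := wt_ne ha j
  simp only [Polynomial.eval_mul, Polynomial.eval_C, eval_Q]
  field_simp

lemma inj_F {n : ℕ} {a : Fin (n + 1) → ℝ} (ha : StrictAnti a) : Set.InjOn (F a) (S a) := by
  rintro z ⟨hz0, hz⟩ z' ⟨hz0', hz'⟩ e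
  have h : Polynomial.C (z' 0) * Q (fun k : Fin n => z' k.succ) =
      Polynomial.C (z 0) * Q (fun k : Fin n => z k.succ) := by
    refine poly_of_F ha ((Polynomial.natDegree_C_mul_le _ _).trans (natDegree_Q _).le) fun j => ?_
    rw [e, F]
    have := wt_ne ha j
    simp only [Polynomial.eval_mul, Polynomial.eval_C, eval_Q]
    field_simp
  have h0 : z' 0 = z 0 := by
    have := congrArg Polynomial.leadingCoeff h
    simpa [Polynomial.leadingCoeff_mul, (monic_Q _).leadingCoeff] using this
  funext c
  refine Fin.cases h0.symm (fun i => ?_) c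
  have h1 := congrArg (Polynomial.eval (z' i.succ)) h
  simp only [Polynomial.eval_mul, Polynomial.eval_C, eval_Q] at h1
  rw [prod_eq_zero (mem_univ i) (sub_self _), mul_zero, eq_comm, mul_eq_zero,
    or_iff_right hz0.ne', prod_eq_zero_iff] at h1
  obtain ⟨k, -, hk⟩ := h1
  have hk : z' i.succ = z k.succ := sub_eq_zero.1 hk
  rcases lt_trichotomy i k with hik | rfl | hik
  · have h1 := R_lt ha hz (j := i.succ) (k := k)
      (Fin.castSucc_lt_iff_succ_le.1 (by simpa using hik))
    have h2 := (hz' i).1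
    simp only at h1 h2; linarith
  · exact hk.symm
  · have h1 := R_lt ha hz' (j := k.succ) (k := i)
      (Fin.castSucc_lt_iff_succ_le.1 (by simpa using hik))
    have h2 := (hz k).1
    simp only at h1 h2; linarith

noncomputable def P {n : ℕ} (a t : Fin (n + 1) → ℝ) : Polynomial ℝ :=
  ∑ j, Polynomial.C (t j) * Q (fun k => a (j.succAbove k))

lemma natDegree_P {n : ℕ} (a t : Fin (n + 1) → ℝ) : (P a t).natDegree ≤ n :=
  Polynomial.natDegree_sum_le_of_forall_le _ _ fun _ _ =>
    (Polynomial.natDegree_C_mul_le _ _).trans (natDegree_Q _).le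

lemma eval_P {n : ℕ} (a t : Fin (n + 1) → ℝ) (j) : (P a t).eval (a j) = t j * wt a j := by
  rw [P, Polynomial.eval_finsetSum, sum_eq_single j]
  · simp [eval_Q, wt]
  · intro i _ hij
    obtain ⟨k, rfl⟩ := Fin.exists_succAbove_eq hij.symm
    simp only [Polynomial.eval_mul, eval_Q]
    rw [prod_eq_zero (mem_univ k) (sub_self _), mul_zero]
  · simp

lemma sum_F {n : ℕ} {a : Fin (n + 1) → ℝ} (ha : StrictAnti a) (z : Fin (n+1) → ℝ) :
    ∑ j, F a z j = z 0 := by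
  have h := poly_of_F (z := z) ha (natDegree_P a (F a z)) (eval_P a _)
  have h2 := congrArg (fun p => Polynomial.coeff p n) h
  have key : ∀ y : Fin n → ℝ, (Q y).coeff n = 1 := fun y => by
    have := (monic_Q y).coeff_natDegree
    rwa [natDegree_Q] at this
  simpa [P, Polynomial.finsetSum_coeff, key] using h2

lemma exists_root {f : ℝ → ℝ} (hf : Continuous f) {u v : ℝ} (huv : u < v) (h : f v * f u < 0) :
    ∃ x, (u < x ∧ x < v) ∧ f x = 0 := by
  rcases mul_neg_iff.1 h with ⟨h1, h2⟩ | ⟨h1, h2⟩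
  · obtain ⟨x, hx, e⟩ := intermediate_value_Ioo huv.le hf.continuousOn ⟨h2, h1⟩
    exact ⟨x, hx, e⟩
  · obtain ⟨x, hx, e⟩ := intermediate_value_Ioo' huv.le hf.continuousOn ⟨h1, h2⟩
    exact ⟨x, hx, e⟩

lemma image_F {n : ℕ} {a : Fin (n + 1) → ℝ} (ha : StrictAnti a) :
    F a '' S a = {t | ∀ j, 0 < t j} := by
  ext t
  constructor
  · rintro ⟨z, ⟨h0, hz⟩, rfl⟩ j
    exact mul_pos h0 (ratio_pos ha hz j)
  · intro ht
    have hroot : ∀ i : Fin n, ∃ x, (a i.succ < x ∧ x < a i.castSucc) ∧ (P a t).eval x = 0 := by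
      intro i
      refine exists_root (P a t).continuous (ha Fin.castSucc_lt_succ) ?_
      rw [eval_P, eval_P, mul_mul_mul_comm]
      exact mul_neg_of_pos_of_neg (mul_pos (ht _) (ht _)) (wt_mul_neg ha i)
    choose y hy hy0 using hroot
    have hyR : y ∈ R a := hy
    have hpos := ratio_pos ha hyR 0
    set r := t 0 / ((∏ k, (a 0 - y k)) / wt a 0) with hr
    have hrpos : 0 < r := div_pos (ht 0) hpos
    have hP : P a t = Polynomial.C r * Q y := by
      refine poly_ext (natDegree_P _ _)
        ((Polynomial.natDegree_C_mul_le _ _).trans (natDegree_Q _).le) (Fin.cons (a 0) y) ?_ ?_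
      · rw [Fin.cons_injective_iff]
        refine ⟨?_, (R_anti ha hyR).injective⟩
        rintro ⟨k, hk⟩
        exact (R_lt ha hyR (Fin.zero_le k.castSucc)).ne hk
      · intro i
        refine Fin.cases ?_ (fun k => ?_) i
        · simp only [Fin.cons_zero, eval_P, Polynomial.eval_mul, Polynomial.eval_C, eval_Q]
          have h1 := wt_ne ha 0
          have h2 : ∏ k, (a 0 - y k) ≠ 0 := fun h => by simp [h] at hpos
          rw [hr]; field_simp
        · simp only [Fin.cons_succ, hy0, Polynomial.eval_mul, eval_Q]
          rw [prod_eq_zero (mem_univ k) (sub_self _), mul_zero]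
    refine ⟨Fin.cons r y, ⟨by simpa using hrpos, by simpa using hyR⟩, ?_⟩
    funext j
    have h := congrArg (Polynomial.eval (a j)) hP
    rw [eval_P, Polynomial.eval_mul, Polynomial.eval_C, eval_Q] at h
    have := wt_ne ha j
    simp only [F, Fin.cons_zero, Fin.cons_succ]
    rw [← mul_div_assoc, ← h]; field_simp

noncomputable def J {n : ℕ} (a : Fin (n + 1) → ℝ) (z : Fin (n+1) → ℝ) :
    Matrix (Fin (n+1)) (Fin (n+1)) ℝ :=
  Matrix.of fun j c => (wt a j)⁻¹ * ((Matrix.of fun j c => (Fin.cons 1 (fun _ => -z 0) : Fin (n+1) → ℝ) c *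
    (Matrix.of fun j c => (q (fun k : Fin n => z k.succ) c).eval (a j)) j c) j c)

noncomputable def F' {n : ℕ} (a : Fin (n + 1) → ℝ) (z : Fin (n+1) → ℝ) :
    (Fin (n+1) → ℝ) →L[ℝ] (Fin (n+1) → ℝ) :=
  LinearMap.toContinuousLinearMap (Matrix.toLin' (J a z))

lemma abs_det_F' {n : ℕ} {a : Fin (n + 1) → ℝ} {z : Fin (n+1) → ℝ}
    (hz0 : 0 < z 0) (hy : StrictAnti (fun k : Fin n => z k.succ)) (ha : StrictAnti a) :
    |(F' a z).det| = (∏ j, |wt a j|)⁻¹ * z 0 ^ n * (∏ i, ∏ j ∈ Ioi i, (a i - a j)) *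
      ∏ i : Fin n, ∏ j ∈ Ioi i, (z i.succ - z j.succ) := by
  have h1 : ∏ i, ∏ j ∈ Ioi i, (a i - a j) = ∏ i, ∏ j ∈ Ioi i, |a j - a i| := by
    refine prod_congr rfl fun i _ => prod_congr rfl fun j hj => ?_
    rw [abs_sub_comm, abs_of_pos (sub_pos.2 (ha (mem_Ioi.1 hj)))]
  have h2 : ∏ i : Fin n, ∏ j ∈ Ioi i, (z i.succ - z j.succ) =
      ∏ i : Fin n, ∏ j ∈ Ioi i, |z j.succ - z i.succ| := by
    refine prod_congr rfl fun i _ => prod_congr rfl fun j hj => ?_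
    rw [abs_sub_comm, abs_of_pos (sub_pos.2 (hy (mem_Ioi.1 hj)))]
  have h3 := abs_det_coeff _ hy.injective
  rw [h1, h2, ← h3, F']
  simp only [ContinuousLinearMap.det, LinearMap.coe_toContinuousLinearMap, LinearMap.det_toLin']
  rw [J, Matrix.det_mul_column, Matrix.det_mul_row, det_q]
  simp only [abs_mul, abs_prod, Fin.prod_univ_succ (fun i => |(Fin.cons 1 (fun _ => -z 0) : Fin (n+1) → ℝ) i|),
    Fin.cons_zero, Fin.cons_succ, abs_inv, prod_inv_distrib, prod_const, card_univ, Fintype.card_fin,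
    abs_neg, abs_of_pos hz0, abs_one]
  ring

lemma hasFDeriv_F {n : ℕ} (a : Fin (n + 1) → ℝ) (z : Fin (n+1) → ℝ) :
    HasFDerivAt (F a) (F' a z) z := by
  rw [hasFDerivAt_pi']
  intro j
  have h0 : HasFDerivAt (fun z : Fin (n+1) → ℝ => z 0)
    (ContinuousLinearMap.proj (R := ℝ) (φ := fun _ : Fin (n+1) => ℝ) 0) z := hasFDerivAt_apply _ _
  have h1 : ∀ k ∈ (univ : Finset (Fin n)), HasFDerivAt (fun z : Fin (n+1) → ℝ => a j - z k.succ)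
    (-ContinuousLinearMap.proj (R := ℝ) (φ := fun _ : Fin (n+1) => ℝ) k.succ) z := fun k _ =>
      (hasFDerivAt_apply _ _).const_sub _
  have h2 := (h0.mul (HasFDerivAt.finsetProd h1)).mul_const (wt a j)⁻¹
  refine (h2.congr_of_eventuallyEq (Filter.Eventually.of_forall fun z => ?_)).congr_fderiv ?_
  · simp only [F, div_eq_mul_inv, mul_assoc, Pi.mul_apply]
  · ext v
    simp [F', J, Matrix.mulVec, dotProduct, Fin.sum_univ_succ, q, eval_Q, Polynomial.eval_prod,
      mul_sum]
    simp only [mul_assoc]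
    rw [add_comm]

lemma measurable_S {n : ℕ} (a : Fin (n + 1) → ℝ) : MeasurableSet (S a) := by
  have : S a = {z | 0 < z 0} ∩ ⋂ i : Fin n, ({z | a i.succ < z i.succ} ∩ {z | z i.succ < a i.castSucc}) := by
    ext z; simp [S, R]
  rw [this]
  refine (measurableSet_lt (by fun_prop) (by fun_prop)).inter (MeasurableSet.iInter fun i => ?_)
  exact (measurableSet_lt (by fun_prop) (by fun_prop)).inter (measurableSet_lt (by fun_prop) (by fun_prop))

noncomputable def D {n : ℕ} (a s : Fin (n + 1) → ℝ) : ℝ :=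
  ∏ i : Fin (n + 1), ∏ j ∈ Finset.Ioi i, (a i - a j) ^ (s i + s j - 1)

lemma D_pos {n : ℕ} {a : Fin (n + 1) → ℝ} (ha : StrictAnti a) (s : Fin (n + 1) → ℝ) : 0 < D a s :=
  prod_pos fun _ _ => prod_pos fun _ hj => Real.rpow_pos_of_pos (sub_pos.2 (ha (mem_Ioi.1 hj))) _

lemma wt_D {n : ℕ} {a : Fin (n + 1) → ℝ} (ha : StrictAnti a) (s : Fin (n + 1) → ℝ) :
    ∏ j, |wt a j| ^ s j = D a s * ∏ i, ∏ j ∈ Ioi i, (a i - a j) := by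
  have h : ∀ j, |wt a j| ^ s j = ∏ k : Fin n, |a j - a (j.succAbove k)| ^ s j := by
    intro j
    rw [wt, abs_prod, Real.finsetProd_rpow _ _ fun _ _ => abs_nonneg _]
  simp only [h]
  rw [offdiag (fun i j => |a i - a j| ^ s i), D, ← prod_mul_distrib]
  refine prod_congr rfl fun i _ => ?_
  rw [← prod_mul_distrib]
  refine prod_congr rfl fun j hj => ?_
  have hp := sub_pos.2 (ha (mem_Ioi.1 hj))
  rw [abs_sub_comm (a j), abs_of_pos hp, ← Real.rpow_add hp, ← Real.rpow_add_one hp.ne']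
  congr 1; ring

lemma integrand {n : ℕ} {a : Fin (n + 1) → ℝ} (ha : StrictAnti a) (s : Fin (n + 1) → ℝ)
    {z : Fin (n+1) → ℝ} (hz : z ∈ S a) :
    |(F' a z).det| * ∏ j, (Real.exp (-F a z j) * F a z j ^ (s j - 1)) =
    (Real.exp (-z 0) * z 0 ^ (∑ i, s i - 1)) *
      ((∏ i : Fin n, ∏ j ∈ Ioi i, (z i.succ - z j.succ)) / D a s *
        ∏ i : Fin n, ∏ j : Fin (n + 1), |z i.succ - a j| ^ (s j - 1)) := by
  obtain ⟨hz0, hy⟩ := hz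
  rw [abs_det_F' hz0 (R_anti ha hy) ha, prod_mul_distrib, ← Real.exp_sum, sum_neg_distrib, sum_F ha]
  have hF : ∀ j, F a z j ^ (s j - 1) = z 0 ^ (s j - 1) *
      ((∏ k : Fin n, |z k.succ - a j| ^ (s j - 1)) * (|wt a j| / |wt a j| ^ (s j))) := by
    intro j
    have h1 : F a z j = z 0 * ((∏ k : Fin n, |z k.succ - a j|) / |wt a j|) := by
      rw [F]
      congr 1
      rw [← abs_of_pos (ratio_pos ha hy j), abs_div, abs_prod]
      simp only [abs_sub_comm (a j)]
    have h2 : 0 ≤ ∏ k : Fin n, |z k.succ - a j| := prod_nonneg fun _ _ => abs_nonneg _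
    rw [h1, Real.mul_rpow hz0.le (by positivity), Real.div_rpow h2 (abs_nonneg _),
      Real.finsetProd_rpow _ _ fun _ _ => abs_nonneg _, Real.rpow_sub_one (abs_ne_zero.2 (wt_ne ha j))]
    congr 1
    rw [div_div_eq_mul_div, mul_div_assoc]
  simp only [hF]
  rw [prod_mul_distrib, prod_mul_distrib, prod_div_distrib, wt_D ha, prod_comm (s := univ) (t := univ)]
  have hzp : z 0 ^ n * ∏ j, z 0 ^ (s j - 1) = z 0 ^ (∑ i, s i - 1) := by
    rw [← Real.rpow_sum_of_pos hz0, ← Real.rpow_natCast, ← Real.rpow_add hz0]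
    congr 1
    simp
    ring
  rw [← hzp]
  have h1 : ∏ j, |wt a j| ≠ 0 := prod_ne_zero_iff.2 fun j _ => abs_ne_zero.2 (wt_ne ha j)
  have h2 : ∏ i, ∏ j ∈ Ioi i, (a i - a j) ≠ 0 :=
    prod_ne_zero_iff.2 fun i _ => prod_ne_zero_iff.2 fun j hj =>
      (sub_pos.2 (ha (mem_Ioi.1 hj))).ne'
  have h3 := (D_pos ha s).ne'
  generalize ∏ j, |wt a j| = A at *
  generalize ∏ i, ∏ j ∈ Ioi i, (a i - a j) = B at *
  field_simp

theorem main {n : ℕ} {a : Fin (n + 1) → ℝ} (ha : StrictAnti a) {s : Fin (n + 1) → ℝ}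
    (hs : ∀ i, 0 < s i) :
    Real.Gamma (∑ i, s i) * ∫ y in R a, ((∏ i : Fin n, ∏ j ∈ Ioi i, (y i - y j)) / D a s *
        ∏ i : Fin n, ∏ j : Fin (n + 1), |y i - a j| ^ (s j - 1)) = ∏ i, Real.Gamma (s i) := by
  have hcv := integral_image_eq_integral_abs_det_fderiv_smul volume (measurable_S a)
    (fun z _ => (hasFDeriv_F a z).hasFDerivWithinAt) (inj_F ha)
    (fun t => ∏ j, (Real.exp (-t j) * t j ^ (s j - 1)))
  have hl : ∫ t in F a '' S a, ∏ j, (Real.exp (-t j) * t j ^ (s j - 1)) = ∏ i, Real.Gamma (s i) := by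
    have : F a '' S a = Set.univ.pi (fun _ : Fin (n+1) => Set.Ioi (0:ℝ)) := by
      rw [image_F ha]; ext; simp
    rw [this, volume_pi, Measure.restrict_pi_pi,
      integral_fintype_prod_eq_prod (fun (j : Fin (n+1)) (x : ℝ) => Real.exp (-x) * x ^ (s j - 1))]
    exact prod_congr rfl fun j _ => (Real.Gamma_eq_integral (hs j)).symm
  rw [hl] at hcv
  rw [hcv]
  simp only [smul_eq_mul]
  rw [setIntegral_congr_fun (measurable_S a) (fun z hz => integrand ha s hz)]
  have e := (volume_preserving_piFinSuccAbove (fun _ : Fin (n+1) => ℝ) 0)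
  have hS : S a = (MeasurableEquiv.piFinSuccAbove (fun _ : Fin (n+1) => ℝ) 0) ⁻¹' (Set.Ioi 0 ×ˢ R a) := by
    ext z; rfl
  have hpos : 0 < ∑ i, s i := sum_pos (fun i _ => hs i) ⟨0, mem_univ _⟩
  rw [hS, Real.Gamma_eq_integral hpos, ← setIntegral_prod_mul, ← Measure.volume_eq_prod,
    ← e.setIntegral_preimage_emb (MeasurableEquiv.measurableEmbedding _)]
  rfl

end DA

/-- For fixed `a_1 > ⋯ > a_n` and `s_1,…,s_n > 0`, the Anderson density
`Γ(Σs)/(ΠΓ(s_i)) · Π_{i<j≤n-1}(y_i-y_j) / Π_{i<j}(a_i-a_j)^{s_i+s_j-1} ·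
Π_{i,j}|y_i - a_j|^{s_j-1}` integrates to 1 over the interlacing region
`a_1 > y_1 > a_2 > ⋯ > y_{n-1} > a_n`. -/
theorem stmt18 (n : ℕ) (a : Fin (n + 1) → ℝ) (ha : StrictAnti a)
    (s : Fin (n + 1) → ℝ) (hs : ∀ i, 0 < s i) :
    (∫ y in {y : Fin n → ℝ | ∀ i : Fin n, a i.succ < y i ∧ y i < a i.castSucc},
      (Real.Gamma (∑ i, s i) / ∏ i, Real.Gamma (s i)) *
        (∏ i : Fin n, ∏ j ∈ Finset.Ioi i, (y i - y j)) /
        (∏ i : Fin (n + 1), ∏ j ∈ Finset.Ioi i, (a i - a j) ^ (s i + s j - 1)) *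
        ∏ i : Fin n, ∏ j : Fin (n + 1), |y i - a j| ^ (s j - 1)) = 1 := by
  have h := DA.main ha hs
  have hG : ∏ i, Real.Gamma (s i) ≠ 0 :=
    Finset.prod_ne_zero_iff.2 fun i _ => (Real.Gamma_pos_of_pos (hs i)).ne'
  simp only [mul_div_assoc, mul_assoc]
  rw [integral_const_mul]
  simp only [DA.R, DA.D] at h
  rw [div_mul_eq_mul_div, div_eq_one_iff_eq hG]
  exact h
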